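/- With the notation of the superdense coding protocol (A₀ = 1, A₁ = !![0,1;1,0], A₂ = !![1,1;0,1], A₃ = A₂ * A₁ over ZMod 2; s (i,j) = 1 iff i = j; rₙ = (Aₙ ⊗ₖ 1) *ᵥ s), the family (r₀, r₁, r₂, r₃) is linearly independent over ZMod 2, and hence forms a basis of the 4-dimensional ZMod 2-vector space Fin 2 × Fin 2 → ZMod 2. -/

import Mathlib

open Matrix
open scoped Kronecker

/-- Alice's four encoding operations in the superdense coding protocol of DQC₂
(encoding `F` as `0` and `T` as `1` in `ZMod 2`). -/
def sdAlice : Fin 4 → Matrix (Fin 2) (Fin 2) (ZMod 2) :=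
  ![1, !![0, 1; 1, 0], !![1, 1; 0, 1], !![1, 1; 0, 1] * !![0, 1; 1, 0]]

/-- The shared entangled state `{(F,F)} ⊎ {(T,T)}`. -/
def sdShared : Fin 2 × Fin 2 → ZMod 2 := fun p => if p.1 = p.2 then 1 else 0

/-- The state reaching Bob after Alice applies her `n`-th operation to the
first qubit. -/
def sdState (n : Fin 4) : Fin 2 × Fin 2 → ZMod 2 :=
  (sdAlice n ⊗ₖ (1 : Matrix (Fin 2) (Fin 2) (ZMod 2))).mulVec sdShared

/-- Bob's state is the vectorization of Alice's matrix. -/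
theorem sdState_apply (n : Fin 4) (p : Fin 2 × Fin 2) :
    sdState n p = sdAlice n p.1 p.2 := by
  simp [sdState, sdShared, mulVec, dotProduct, Fintype.sum_prod_type, one_apply]

theorem linearIndependent_sdState : LinearIndependent (ZMod 2) sdState := by
  rw [Fintype.linearIndependent_iff]
  intro g hg
  have h (i j : Fin 2) : ∑ n, g n * sdAlice n i j = 0 := by
    simpa [sdState_apply] using congrFun hg (i, j)
  have h00 := h 0 0
  have h01 := h 0 1
  have h10 := h 1 0
  have h11 := h 1 1
  simp [Fin.sum_univ_four, sdAlice] at h00 h01 h10 h11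
  have h3 : g 3 = 0 := by linear_combination h00 - h11
  have h1 : g 1 = 0 := by linear_combination h10 - h3
  have h2 : g 2 = 0 := by linear_combination h01 - h1 - h3
  have h0 : g 0 = 0 := by linear_combination h11 - h2
  intro n
  fin_cases n
  exacts [h0, h1, h2, h3]

/-- The four possible states reaching Bob in the superdense coding protocol
are linearly independent over `ZMod 2`, hence form a basis of the
4-dimensional space `Fin 2 × Fin 2 → ZMod 2`. -/
theorem superdense_states_linearIndependent_and_span :
    LinearIndependent (ZMod 2) sdState ∧
    Submodule.span (ZMod 2) (Set.range sdState) = ⊤ := by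
  exact ⟨linearIndependent_sdState,
    linearIndependent_sdState.span_eq_top_of_card_eq_finrank' (by simp)⟩
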